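/- There exist a positive integer Ñ with a partition Ñ = ñ_1 + … + ñ_r, a family Ṽ = {Ṽ_{lk} ⊆ Mat(ñ_l×ñ_k, ℝ)}_{1≤k<l≤r} satisfying (V1)–(V3), and a linear isomorphism l : 𝒵_Ṽ → 𝒵 such that l(𝒫_Ṽ) = 𝒬 and, for every s ∈ ℝ^r and every x ∈ 𝒫_Ṽ, Δ^Ṽ_{s*}(x) = δ_s(l(x)), where s* := (s_r,…,s_1). In this case, s ∈ Ξ if and only if s* ∈ 𝔛_Ṽ (the Gindikin sets of the respective data). -/

import Mathlib

open Matrix MeasureTheory Finset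
open scoped ENNReal

namespace Wishart

instance {m n α : Type*} [MeasurableSpace α] : MeasurableSpace (Matrix m n α) :=
  inferInstanceAs (MeasurableSpace (m → n → α))

/-- Index set of an `N × N` matrix partitioned into `r + 1` blocks of sizes `n 0, …, n r`. -/
abbrev Idx (r : ℕ) (n : Fin (r + 1) → ℕ+) := Σ k : Fin (r + 1), Fin (n k)

/-- Real matrices over the partitioned index set. -/
abbrev Mat (r : ℕ) (n : Fin (r + 1) → ℕ+) := Matrix (Idx r n) (Idx r n) ℝ

variable {r : ℕ} {n : Fin (r + 1) → ℕ+}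

/-- The `(l,k)` block of a partitioned matrix. -/
def blk (x : Mat r n) (l k : Fin (r + 1)) : Matrix (Fin (n l)) (Fin (n k)) ℝ :=
  Matrix.of fun a b => x ⟨l, a⟩ ⟨k, b⟩

variable (V : ∀ l k : Fin (r + 1), Submodule ℝ (Matrix (Fin (n l)) (Fin (n k)) ℝ))

/-- Condition (V1): `A ∈ 𝒱_{lk}`, `B ∈ 𝒱_{ki}` implies `A B ∈ 𝒱_{li}` for `i < k < l`. -/
def CondV1 : Prop := ∀ i k l : Fin (r + 1), i < k → k < l →
  ∀ A ∈ V l k, ∀ B ∈ V k i, A * B ∈ V l i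

/-- Condition (V2): `A ∈ 𝒱_{li}`, `B ∈ 𝒱_{ki}` implies `A Bᵀ ∈ 𝒱_{lk}` for `i < k < l`. -/
def CondV2 : Prop := ∀ i k l : Fin (r + 1), i < k → k < l →
  ∀ A ∈ V l i, ∀ B ∈ V k i, A * Bᵀ ∈ V l k

/-- Condition (V3): `A ∈ 𝒱_{lk}` implies `A Aᵀ ∈ ℝ I`. -/
def CondV3 : Prop := ∀ k l : Fin (r + 1), k < l →
  ∀ A ∈ V l k, ∃ c : ℝ, A * Aᵀ = c • (1 : Matrix (Fin (n l)) (Fin (n l)) ℝ)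

/-- The space `𝒵` of symmetric matrices with lower blocks in `𝒱_{lk}` and scalar diagonal
blocks. -/
def Zspace : Set (Mat r n) :=
  {x | x.IsSymm ∧ (∀ k l : Fin (r + 1), k < l → blk x l k ∈ V l k) ∧
    ∀ k : Fin (r + 1), ∃ c : ℝ, ∀ a b : Fin (n k),
      x ⟨k, a⟩ ⟨k, b⟩ = if a = b then c else 0}

/-- The trace inner product `⟨x, y⟩ = tr (x y)`. -/
def tip (x y : Mat r n) : ℝ := (x * y).trace

/-- The homogeneous cone `𝒫 = 𝒵 ∩ Sym₊(N, ℝ)`. -/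
def Pcone : Set (Mat r n) := {x | x ∈ Zspace V ∧ x.PosDef}

/-- The dual cone `𝒬 = {ξ ∈ 𝒵 : ⟨ξ, x⟩ > 0 for all nonzero x in the closure of 𝒫}`. -/
def Qcone : Set (Mat r n) :=
  {ξ | ξ ∈ Zspace V ∧ ∀ x ∈ closure (Pcone V), x ≠ 0 → 0 < tip ξ x}

/-- The group `H` of block lower triangular matrices with strictly lower blocks in `𝒱_{lk}`
and positive scalar diagonal blocks. -/
def Hgrp : Set (Mat r n) :=
  {T | (∀ k l : Fin (r + 1), l < k → blk T l k = 0) ∧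
    (∀ k l : Fin (r + 1), k < l → blk T l k ∈ V l k) ∧
    ∀ k : Fin (r + 1), ∃ t : ℝ, 0 < t ∧ ∀ a b : Fin (n k),
      T ⟨k, a⟩ ⟨k, b⟩ = if a = b then t else 0}

/-- `ρ(T) x = T x Tᵀ`. -/
def rhoM (T x : Mat r n) : Mat r n := T * x * Tᵀ

/-- The diagonal scalar `t_{kk}` of a matrix with scalar diagonal blocks. -/
def tdiag (T : Mat r n) (k : Fin (r + 1)) : ℝ :=
  T ⟨k, ⟨0, (n k).2⟩⟩ ⟨k, ⟨0, (n k).2⟩⟩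

/-- The one-dimensional representation `χ_s(T) = ∏_k t_{kk}^{2 s_k}`. -/
noncomputable def chi (s : Fin (r + 1) → ℝ) (T : Mat r n) : ℝ :=
  ∏ k : Fin (r + 1), tdiag T k ^ (2 * s k)

/-- `½ Σ_{i<k} ε_i dim 𝒱_{ki}`. -/
noncomputable def xiBound (ε : Fin (r + 1) → Bool) (k : Fin (r + 1)) : ℝ :=
  (1 / 2) * ∑ i ∈ Finset.univ.filter (fun i => i < k),
    (if ε i then (Module.finrank ℝ (V k i) : ℝ) else 0)

/-- The Gindikin set `Ξ`. -/
def XiSet : Set (Fin (r + 1) → ℝ) :=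
  ⋃ ε : Fin (r + 1) → Bool,
    {s | ∀ k, (ε k = true → xiBound V ε k < s k) ∧ (ε k = false → s k = xiBound V ε k)}

/-- `½ Σ_{l>k} ε_l dim 𝒱_{lk}`. -/
noncomputable def frakBound (ε : Fin (r + 1) → Bool) (k : Fin (r + 1)) : ℝ :=
  (1 / 2) * ∑ l ∈ Finset.univ.filter (fun l => k < l),
    (if ε l then (Module.finrank ℝ (V l k) : ℝ) else 0)

/-- The Gindikin set `𝔛`. -/
def frakX : Set (Fin (r + 1) → ℝ) :=
  ⋃ ε : Fin (r + 1) → Bool,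
    {s | ∀ k, (ε k = true → frakBound V ε k < s k) ∧ (ε k = false → s k = frakBound V ε k)}

/-- Laplace transform `L_μ(θ) = ∫ e^{-⟨θ,x⟩} dμ(x)` (with values in `[0,∞]`). -/
noncomputable def laplace (μ : Measure (Mat r n)) (θ : Mat r n) : ℝ≥0∞ :=
  ∫⁻ x, ENNReal.ofReal (Real.exp (-(tip θ x))) ∂μ

/-- Real-valued Laplace transform. -/
noncomputable def laplaceR (μ : Measure (Mat r n)) (θ : Mat r n) : ℝ :=
  ∫ x, Real.exp (-(tip θ x)) ∂μ

/-- Mean of the natural-exponential-family member `P(θ,μ)`, computed entrywise: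
`m_μ(θ) = L_μ(θ)⁻¹ ∫ x e^{-⟨θ,x⟩} dμ(x)`. -/
noncomputable def meanMap (μ : Measure (Mat r n)) (θ : Mat r n) : Mat r n :=
  Matrix.of fun p q => (laplaceR μ θ)⁻¹ * ∫ x, Real.exp (-(tip θ x)) * x p q ∂μ

/-- Covariance operator of `P(θ,μ)` with mean `m`, applied to `ξ ∈ 𝒵` (entrywise):
`V ξ = ∫ ⟨ξ, x - m⟩ (x - m) dP(θ,μ)(x)`. -/
noncomputable def varOp (μ : Measure (Mat r n)) (θ m ξ : Mat r n) : Mat r n :=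
  Matrix.of fun p q =>
    (laplaceR μ θ)⁻¹ * ∫ x, Real.exp (-(tip θ x)) * tip ξ (x - m) * ((x - m) p q) ∂μ

/-- Leading principal submatrix `y_{{1:k}}` consisting of the blocks with indices `≤ k`. -/
def lead (k : Fin (r + 1)) (y : Mat r n) :
    Matrix {p : Idx r n // p.1 ≤ k} {p : Idx r n // p.1 ≤ k} ℝ :=
  Matrix.of fun p q => y p.1 q.1

/-- Zero-padding `z₀` of a matrix `z` defined on the blocks with indices `≤ k`. -/
def pad (k : Fin (r + 1)) (z : Matrix {p : Idx r n // p.1 ≤ k} {p : Idx r n // p.1 ≤ k} ℝ) :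
    Mat r n :=
  Matrix.of fun p q => if h : p.1 ≤ k ∧ q.1 ≤ k then z ⟨p, h.1⟩ ⟨q, h.2⟩ else 0

/-- `J_k = (I_{N_k})₀`. -/
def Jmat (k : Fin (r + 1)) : Mat r n := pad k 1

/-- Parameters of elements of `W_i`: the scalar `x_{ii}` and the blocks `X_{li}`. -/
abbrev Wparam (r : ℕ) (n : Fin (r + 1) → ℕ+) (i : Fin (r + 1)) :=
  ℝ × ∀ l : Fin (r + 1), Matrix (Fin (n l)) (Fin (n i)) ℝ

/-- The `N × n_i` matrix in `W_i` with `i`-th block row `x_{ii} I` and `l`-th block row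
`X_{li}` for `l > i`. -/
def toW (i : Fin (r + 1)) (p : Wparam r n i) : Matrix (Idx r n) (Fin (n i)) ℝ :=
  Matrix.of fun q b =>
    if q.1 = i then (if (q.2 : ℕ) = (b : ℕ) then p.1 else 0)
    else if i < q.1 then p.2 q.1 q.2 b else 0

/-- A parameter tuple gives an honest element of `W_i`: blocks lie in `𝒱_{li}` and vanish
for `l ≤ i`. -/
def WGood (i : Fin (r + 1)) (p : Wparam r n i) : Prop :=
  (∀ l : Fin (r + 1), i < l → p.2 l ∈ V l i) ∧ (∀ l : Fin (r + 1), ¬ i < l → p.2 l = 0)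

/-- The inner product `(A|B)` on `𝒱_{lk}`, characterized by `(ABᵀ + BAᵀ)/2 = (A|B) I`. -/
noncomputable def bip (l : Fin (r + 1)) {k : Fin (r + 1)}
    (A B : Matrix (Fin (n l)) (Fin (n k)) ℝ) : ℝ :=
  (A * Bᵀ).trace / (n l : ℝ)

open scoped Classical in
/-- The generalized power function `Δ_s` on `𝒫`, defined by `Δ_s(ρ(T) I) = χ_s(T)`. -/
noncomputable def DeltaDef (s : Fin (r + 1) → ℝ) (x : Mat r n) : ℝ :=
  if h : ∃ T, T ∈ Hgrp V ∧ x = rhoM T 1 then chi s h.choose else 0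

/-- Index set for the block diagonal matrix `Φ(ξ) = diag(φ_0(ξ), …, φ_r(ξ))`,
where `φ_i(ξ)` is of size `m_i = mdc i + 1`. -/
abbrev DIdx (r : ℕ) (mdc : Fin (r + 1) → ℕ) := Σ i : Fin (r + 1), Fin (mdc i + 1)

/-- The block diagonal matrix `Φ(ξ) = diag(φ_0(ξ), …, φ_r(ξ))`. -/
def PhiMat {mdc : Fin (r + 1) → ℕ}
    (φ : ∀ i : Fin (r + 1), Mat r n → Matrix (Fin (mdc i + 1)) (Fin (mdc i + 1)) ℝ)
    (ξ : Mat r n) : Matrix (DIdx r mdc) (DIdx r mdc) ℝ :=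
  Matrix.of fun p q =>
    if h : p.1 = q.1 then φ p.1 ξ p.2 (Fin.cast (by rw [h]) q.2) else 0

/-- `Φ(I_N)^{-1/2}`: the inverse square root of the (diagonal, positive) matrix `Φ(I_N)`. -/
noncomputable def PhiISqrtInv {mdc : Fin (r + 1) → ℕ}
    (φ : ∀ i : Fin (r + 1), Mat r n → Matrix (Fin (mdc i + 1)) (Fin (mdc i + 1)) ℝ) :
    Matrix (DIdx r mdc) (DIdx r mdc) ℝ :=
  Matrix.diagonal fun p => (PhiMat φ (1 : Mat r n) p p) ^ (-(1 / 2) : ℝ)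

/-- The family `𝒱` extended by the scalar matrices on the diagonal and by zero above it. -/
def extV (l k : Fin (r + 1)) : Submodule ℝ (Matrix (Fin (n l)) (Fin (n k)) ℝ) where
  carrier := {A | (k < l → A ∈ V l k) ∧ (l < k → A = 0) ∧
    (l = k → ∃ c : ℝ, ∀ a b, A a b = if (a : ℕ) = (b : ℕ) then c else 0)}
  add_mem' := by
    rintro A B ⟨hA1, hA2, hA3⟩ ⟨hB1, hB2, hB3⟩
    refine ⟨fun h => add_mem (hA1 h) (hB1 h), fun h => by rw [hA2 h, hB2 h, add_zero],
      fun h => ?_⟩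
    obtain ⟨c, hc⟩ := hA3 h
    obtain ⟨d, hd⟩ := hB3 h
    refine ⟨c + d, fun a b => ?_⟩
    rw [Matrix.add_apply, hc, hd]
    split_ifs <;> simp
  zero_mem' := ⟨fun _ => zero_mem _, fun _ => rfl, fun _ => ⟨0, fun a b => by simp⟩⟩
  smul_mem' := by
    rintro t A ⟨hA1, hA2, hA3⟩
    refine ⟨fun h => Submodule.smul_mem _ _ (hA1 h), fun h => by rw [hA2 h, smul_zero],
      fun h => ?_⟩
    obtain ⟨c, hc⟩ := hA3 h
    refine ⟨t * c, fun a b => ?_⟩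
    rw [Matrix.smul_apply, hc]
    split_ifs <;> simp

variable {V}

theorem mem_extV_of_lt {l k : Fin (r + 1)} (h : k < l) {A : Matrix (Fin (n l)) (Fin (n k)) ℝ} :
    A ∈ extV V l k ↔ A ∈ V l k :=
  ⟨fun hA => hA.1 h, fun hA => ⟨fun _ => hA, fun h' => absurd h' h.not_gt,
    fun h' => absurd h' h.ne'⟩⟩

theorem mem_extV_self {l : Fin (r + 1)} {A : Matrix (Fin (n l)) (Fin (n l)) ℝ} :
    A ∈ extV V l l ↔ ∃ c : ℝ, A = c • 1 := by
  constructor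
  · rintro ⟨-, -, hA⟩
    obtain ⟨c, hc⟩ := hA rfl
    refine ⟨c, ?_⟩
    ext a b
    simp [hc, Matrix.one_apply, Fin.ext_iff]
  · rintro ⟨c, rfl⟩
    refine ⟨fun h => absurd h (lt_irrefl _), fun h => absurd h (lt_irrefl _), fun _ => ⟨c, ?_⟩⟩
    intro a b
    simp [Matrix.one_apply, Fin.ext_iff]

theorem mem_extV_of_gt {l k : Fin (r + 1)} (h : l < k) {A : Matrix (Fin (n l)) (Fin (n k)) ℝ} :
    A ∈ extV V l k ↔ A = 0 :=
  ⟨fun hA => hA.2.1 h, fun hA => hA ▸ zero_mem _⟩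

theorem mul_mem_extV (hV1 : CondV1 V) {l k i : Fin (r + 1)}
    {A : Matrix (Fin (n l)) (Fin (n k)) ℝ} {B : Matrix (Fin (n k)) (Fin (n i)) ℝ}
    (hA : A ∈ extV V l k) (hB : B ∈ extV V k i) : A * B ∈ extV V l i := by
  rcases lt_trichotomy l k with h | rfl | h
  · rw [(mem_extV_of_gt h).1 hA, Matrix.zero_mul]
    exact zero_mem _
  · obtain ⟨c, rfl⟩ := mem_extV_self.1 hA
    rw [Matrix.smul_mul, Matrix.one_mul]
    exact Submodule.smul_mem _ _ hB
  rcases lt_trichotomy k i with h' | rfl | h'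
  · rw [(mem_extV_of_gt h').1 hB, Matrix.mul_zero]
    exact zero_mem _
  · obtain ⟨c, rfl⟩ := mem_extV_self.1 hB
    rw [Matrix.mul_smul, Matrix.mul_one]
    exact Submodule.smul_mem _ _ hA
  · rw [mem_extV_of_lt h] at hA
    rw [mem_extV_of_lt h'] at hB
    exact (mem_extV_of_lt (h'.trans h)).2 (hV1 i k l h' h A hA B hB)

theorem mul_transpose_mem_extV (hV2 : CondV2 V) {l k i : Fin (r + 1)} (hkl : k < l)
    {A : Matrix (Fin (n l)) (Fin (n i)) ℝ} {B : Matrix (Fin (n k)) (Fin (n i)) ℝ}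
    (hA : A ∈ extV V l i) (hB : B ∈ extV V k i) : A * Bᵀ ∈ extV V l k := by
  rcases lt_trichotomy k i with h | rfl | h
  · rw [(mem_extV_of_gt h).1 hB, Matrix.transpose_zero, Matrix.mul_zero]
    exact zero_mem _
  · obtain ⟨c, rfl⟩ := mem_extV_self.1 hB
    rw [Matrix.transpose_smul, Matrix.transpose_one, Matrix.mul_smul, Matrix.mul_one]
    exact Submodule.smul_mem _ _ hA
  · rw [mem_extV_of_lt (h.trans hkl)] at hA
    rw [mem_extV_of_lt h] at hB
    exact (mem_extV_of_lt hkl).2 (hV2 i k l h hkl A hA B hB)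

theorem mul_transpose_self_mem_extV (hV3 : CondV3 V) {l i : Fin (r + 1)}
    {A : Matrix (Fin (n l)) (Fin (n i)) ℝ} (hA : A ∈ extV V l i) : A * Aᵀ ∈ extV V l l := by
  rcases lt_trichotomy l i with h | rfl | h
  · rw [(mem_extV_of_gt h).1 hA, Matrix.zero_mul]
    exact zero_mem _
  · obtain ⟨c, rfl⟩ := mem_extV_self.1 hA
    exact mem_extV_self.2 ⟨c * c, by simp [smul_smul]⟩
  · rw [mem_extV_of_lt h] at hA
    exact mem_extV_self.2 (hV3 i l h A hA)

variable (n) in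
/-- The inclusion of the `k`-th block as an `N × n_k` matrix. -/
def blkIncl (k : Fin (r + 1)) : Matrix (Idx r n) (Fin (n k)) ℝ :=
  (1 : Mat r n).submatrix id (fun a => ⟨k, a⟩)

theorem mul_blkIncl {m : Type*} (X : Matrix m (Idx r n) ℝ) (k : Fin (r + 1)) :
    X * blkIncl n k = X.submatrix id (fun a => ⟨k, a⟩) := by
  ext a b
  simp [blkIncl, Matrix.mul_apply, Matrix.one_apply]

theorem blkIncl_transpose_mul {m : Type*} (X : Matrix (Idx r n) m ℝ) (k : Fin (r + 1)) :
    (blkIncl n k)ᵀ * X = X.submatrix (fun a => ⟨k, a⟩) id := by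
  ext a b
  simp [blkIncl, Matrix.mul_apply, Matrix.one_apply]

theorem blk_eq (X : Mat r n) (l k : Fin (r + 1)) :
    blk X l k = (blkIncl n l)ᵀ * X * blkIncl n k := by
  rw [mul_blkIncl, blkIncl_transpose_mul]
  rfl

theorem sum_blkIncl_mul_transpose :
    ∑ k : Fin (r + 1), blkIncl n k * (blkIncl n k)ᵀ = (1 : Mat r n) := by
  ext p q
  obtain ⟨l, a⟩ := p
  obtain ⟨k, b⟩ := q
  rw [Matrix.sum_apply]
  trans ∑ p : Idx r n, (1 : Mat r n) ⟨l, a⟩ p * (1 : Mat r n) ⟨k, b⟩ p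
  · rw [Fintype.sum_sigma]
    rfl
  · simp [Matrix.one_apply, @eq_comm _ (⟨k, b⟩ : Idx r n)]

theorem ext_blk {X Y : Mat r n} (h : ∀ l k, blk X l k = blk Y l k) : X = Y := by
  ext ⟨l, a⟩ ⟨k, b⟩
  exact congrFun (congrFun (h l k) a) b

theorem blk_transpose (X : Mat r n) (l k : Fin (r + 1)) : blk Xᵀ l k = (blk X k l)ᵀ := rfl

theorem mul_eq_sum_blkIncl {m m' : Type*} (X : Matrix m (Idx r n) ℝ) (Y : Matrix (Idx r n) m' ℝ) :
    X * Y = ∑ k, (X * blkIncl n k) * ((blkIncl n k)ᵀ * Y) := by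
  calc X * Y = X * (∑ k : Fin (r + 1), blkIncl n k * (blkIncl n k)ᵀ) * Y := by
        rw [sum_blkIncl_mul_transpose, Matrix.mul_one]
    _ = _ := by
        rw [Matrix.mul_sum, Matrix.sum_mul]
        simp only [Matrix.mul_assoc]

theorem blk_mul (X Y : Mat r n) (l i : Fin (r + 1)) :
    blk (X * Y) l i = ∑ k, blk X l k * blk Y k i := by
  rw [blk_eq, ← Matrix.mul_assoc, Matrix.mul_assoc, mul_eq_sum_blkIncl]
  simp only [blk_eq, Matrix.mul_assoc]

theorem blk_one_self (l : Fin (r + 1)) : blk (1 : Mat r n) l l = 1 := by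
  ext a b
  simp [blk, Matrix.one_apply]

theorem blk_one_of_ne {l k : Fin (r + 1)} (h : l ≠ k) : blk (1 : Mat r n) l k = 0 := by
  ext a b
  simp [blk, h]

variable (V) in
/-- The space of `l`-th block rows of block lower triangular matrices with blocks in `extV V`. -/
def rowSpace (l : Fin (r + 1)) : Submodule ℝ (Matrix (Fin (n l)) (Idx r n) ℝ) where
  carrier := {X | ∀ i, X * blkIncl n i ∈ extV V l i}
  add_mem' hX hY i := by
    rw [Matrix.add_mul]
    exact add_mem (hX i) (hY i)
  zero_mem' i := by
    rw [Matrix.zero_mul]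
    exact zero_mem _
  smul_mem' c X hX i := by
    rw [Matrix.smul_mul]
    exact Submodule.smul_mem _ _ (hX i)

theorem mul_mem_rowSpace (hV1 : CondV1 V) {l k : Fin (r + 1)}
    {A : Matrix (Fin (n l)) (Fin (n k)) ℝ} {X : Matrix (Fin (n k)) (Idx r n) ℝ}
    (hA : A ∈ extV V l k) (hX : X ∈ rowSpace V k) : A * X ∈ rowSpace V l := fun i => by
  rw [Matrix.mul_assoc]
  exact mul_mem_extV hV1 hA (hX i)

theorem mul_transpose_mem_of_rowSpace (hV2 : CondV2 V) {l k : Fin (r + 1)} (hkl : k < l)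
    {X : Matrix (Fin (n l)) (Idx r n) ℝ} {Y : Matrix (Fin (n k)) (Idx r n) ℝ}
    (hX : X ∈ rowSpace V l) (hY : Y ∈ rowSpace V k) : X * Yᵀ ∈ extV V l k := by
  rw [mul_eq_sum_blkIncl]
  refine sum_mem fun i _ => ?_
  rw [← Matrix.transpose_mul]
  exact mul_transpose_mem_extV hV2 hkl (hX i) (hY i)

theorem mul_transpose_self_mem_of_rowSpace (hV3 : CondV3 V) {l : Fin (r + 1)}
    {X : Matrix (Fin (n l)) (Idx r n) ℝ} (hX : X ∈ rowSpace V l) : X * Xᵀ ∈ extV V l l := by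
  rw [mul_eq_sum_blkIncl]
  refine sum_mem fun i _ => ?_
  rw [← Matrix.transpose_mul]
  exact mul_transpose_self_mem_extV hV3 (hX i)

theorem polar_mem_of_rowSpace (hV3 : CondV3 V) {l : Fin (r + 1)}
    {X Y : Matrix (Fin (n l)) (Idx r n) ℝ} (hX : X ∈ rowSpace V l) (hY : Y ∈ rowSpace V l) :
    X * Yᵀ + Y * Xᵀ ∈ extV V l l := by
  have h : X * Yᵀ + Y * Xᵀ = (X + Y) * (X + Y)ᵀ - X * Xᵀ - Y * Yᵀ := by
    rw [Matrix.transpose_add, Matrix.add_mul, Matrix.mul_add, Matrix.mul_add]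
    abel
  rw [h]
  exact sub_mem (sub_mem (mul_transpose_self_mem_of_rowSpace hV3 (add_mem hX hY))
    (mul_transpose_self_mem_of_rowSpace hV3 hX)) (mul_transpose_self_mem_of_rowSpace hV3 hY)

variable (V) in
/-- The algebra of block lower triangular matrices with blocks in `extV V`. -/
def triSpace : Submodule ℝ (Mat r n) where
  carrier := {T | ∀ l k, blk T l k ∈ extV V l k}
  add_mem' hX hY l k := add_mem (hX l k) (hY l k)
  zero_mem' l k := zero_mem (extV V l k)
  smul_mem' c _ hX l k := Submodule.smul_mem _ c (hX l k)

theorem blkIncl_transpose_mul_mem_rowSpace {T : Mat r n} (hT : T ∈ triSpace V)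
    (l : Fin (r + 1)) : (blkIncl n l)ᵀ * T ∈ rowSpace V l := fun i => by
  rw [← blk_eq]
  exact hT l i

theorem one_mem_triSpace : (1 : Mat r n) ∈ triSpace V := fun l k => by
  rcases eq_or_ne l k with rfl | h
  · rw [blk_one_self]
    exact mem_extV_self.2 ⟨1, (one_smul _ _).symm⟩
  · rw [blk_one_of_ne h]
    exact zero_mem _

theorem mem_Zspace {x : Mat r n} :
    x ∈ Zspace V ↔ x.IsSymm ∧ ∀ l k, k ≤ l → blk x l k ∈ extV V l k := by
  refine and_congr_right fun _ => ⟨fun ⟨h1, h2⟩ l k hkl => ?_, fun h => ⟨fun k l hkl => ?_,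
    fun k => ?_⟩⟩
  · rcases hkl.lt_or_eq with h | rfl
    · exact (mem_extV_of_lt h).2 (h1 k l h)
    · obtain ⟨c, hc⟩ := h2 k
      refine mem_extV_self.2 ⟨c, ?_⟩
      ext a b
      simp [blk, hc, Matrix.one_apply]
  · exact (mem_extV_of_lt hkl).1 (h l k hkl.le)
  · obtain ⟨c, hc⟩ := mem_extV_self.1 (h k k le_rfl)
    refine ⟨c, fun a b => ?_⟩
    have := congrFun (congrFun hc a) b
    simpa [blk, Matrix.one_apply] using this

theorem tdiag_eq {T : Mat r n} {k : Fin (r + 1)} {c : ℝ} (h : blk T k k = c • 1) :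
    tdiag T k = c := by
  have := congrFun (congrFun h ⟨0, (n k).2⟩) ⟨0, (n k).2⟩
  rw [Matrix.smul_apply, Matrix.one_apply_eq, smul_eq_mul, mul_one] at this
  exact this

theorem mem_Hgrp {T : Mat r n} : T ∈ Hgrp V ↔ T ∈ triSpace V ∧ ∀ k, 0 < tdiag T k := by
  constructor
  · rintro ⟨h1, h2, h3⟩
    have h4 : ∀ k, ∃ t : ℝ, 0 < t ∧ blk T k k = t • 1 := fun k => by
      obtain ⟨t, ht, h⟩ := h3 k
      refine ⟨t, ht, ?_⟩
      ext a b
      simp [blk, h, Matrix.one_apply]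
    refine ⟨fun l k => ?_, fun k => ?_⟩
    · rcases lt_trichotomy l k with h | rfl | h
      · exact (mem_extV_of_gt h).2 (h1 k l h)
      · obtain ⟨t, -, h⟩ := h4 l
        exact mem_extV_self.2 ⟨t, h⟩
      · exact (mem_extV_of_lt h).2 (h2 k l h)
    · obtain ⟨t, ht, h⟩ := h4 k
      rwa [tdiag_eq h]
  · rintro ⟨h1, h2⟩
    refine ⟨fun k l h => (mem_extV_of_gt h).1 (h1 l k), fun k l h =>
      (mem_extV_of_lt h).1 (h1 l k), fun k => ?_⟩
    obtain ⟨c, hc⟩ := mem_extV_self.1 (h1 k k)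
    refine ⟨c, tdiag_eq hc ▸ h2 k, fun a b => ?_⟩
    have := congrFun (congrFun hc a) b
    simpa [blk, Matrix.one_apply] using this

variable (V) in
/-- `Zspace V` as a submodule. -/
def Zsub : Submodule ℝ (Mat r n) where
  carrier := Zspace V
  add_mem' := by
    intro x y hx hy
    rw [mem_Zspace] at *
    exact ⟨hx.1.add hy.1, fun l k h => add_mem (hx.2 l k h) (hy.2 l k h)⟩
  zero_mem' := mem_Zspace.2 ⟨Matrix.transpose_zero, fun l k _ => zero_mem (extV V l k)⟩
  smul_mem' := by
    intro c x hx
    rw [mem_Zspace] at *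
    exact ⟨hx.1.smul c, fun l k h => Submodule.smul_mem _ c (hx.2 l k h)⟩

theorem mul_transpose_mem_Zspace (hV2 : CondV2 V) (hV3 : CondV3 V) {u : Mat r n}
    (hu : u ∈ triSpace V) : u * uᵀ ∈ Zspace V := by
  refine mem_Zspace.2 ⟨Matrix.isSymm_mul_transpose_self u, fun l k hkl => ?_⟩
  have h : blk (u * uᵀ) l k = ((blkIncl n l)ᵀ * u) * ((blkIncl n k)ᵀ * u)ᵀ := by
    simp only [blk_eq, Matrix.mul_assoc, Matrix.transpose_mul, Matrix.transpose_transpose]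
  rw [h]
  rcases hkl.lt_or_eq with hkl | rfl
  · exact mul_transpose_mem_of_rowSpace hV2 hkl (blkIncl_transpose_mul_mem_rowSpace hu l)
      (blkIncl_transpose_mul_mem_rowSpace hu k)
  · exact mul_transpose_self_mem_of_rowSpace hV3 (blkIncl_transpose_mul_mem_rowSpace hu k)

theorem one_mem_Zspace : (1 : Mat r n) ∈ Zspace V :=
  mem_Zspace.2 ⟨Matrix.transpose_one, fun l k _ => one_mem_triSpace l k⟩

theorem blkIncl_transpose_mul_self (k : Fin (r + 1)) : (blkIncl n k)ᵀ * blkIncl n k = 1 := by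
  have := blk_eq (1 : Mat r n) k k
  rwa [blk_one_self, Matrix.mul_one, eq_comm] at this

theorem blkIncl_transpose_mul_of_ne {l k : Fin (r + 1)} (h : l ≠ k) :
    (blkIncl n l)ᵀ * blkIncl n k = 0 := by
  have := blk_eq (1 : Mat r n) l k
  rwa [blk_one_of_ne h, Matrix.mul_one, eq_comm] at this

theorem tdiag_eq_mul_blkIncl (T : Mat r n) (k : Fin (r + 1)) :
    tdiag T k = (T * blkIncl n k) ⟨k, ⟨0, (n k).2⟩⟩ ⟨0, (n k).2⟩ := by
  rw [mul_blkIncl]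
  rfl

theorem dotProduct_mulVec_comm {m m' : Type*} [Fintype m] [Fintype m'] (A : Matrix m m' ℝ)
    (w : m' → ℝ) (z : m → ℝ) : (A *ᵥ w) ⬝ᵥ z = w ⬝ᵥ (Aᵀ *ᵥ z) := by
  rw [dotProduct_comm, Matrix.dotProduct_mulVec, Matrix.mulVec_transpose, dotProduct_comm]

/-- One step of the block Cholesky elimination. -/
theorem exists_elimination_step (hV2 : CondV2 V) (hV3 : CondV3 V) {y : Mat r n}
    (hy : y ∈ Zspace V) (m : Fin (r + 1)) (hzero : ∀ k < m, (blkIncl n k)ᵀ * y = 0)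
    (hpos : ∀ v : Idx r n → ℝ, v ≠ 0 → (∀ k < m, (blkIncl n k)ᵀ *ᵥ v = 0) → 0 < v ⬝ᵥ (y *ᵥ v)) :
    ∃ S y' : Mat r n, y = S * Sᵀ + y' ∧ S ∈ triSpace V ∧ 0 < tdiag S m ∧
      (∀ k, k ≠ m → S * blkIncl n k = 0) ∧ y' ∈ Zspace V ∧
      (∀ k ≤ m, (blkIncl n k)ᵀ * y' = 0) ∧
      ∀ v : Idx r n → ℝ, v ≠ 0 → (∀ k ≤ m, (blkIncl n k)ᵀ *ᵥ v = 0) → 0 < v ⬝ᵥ (y' *ᵥ v) := by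
  rw [mem_Zspace] at hy
  obtain ⟨hsymm, hblk⟩ := hy
  obtain ⟨c, hc⟩ := mem_extV_self.1 (hblk m m le_rfl)
  rw [blk_eq] at hc
  set J := blkIncl n m with hJ
  have hsymm' : yᵀ = y := hsymm
  have hJJ : Jᵀ * J = 1 := blkIncl_transpose_mul_self m
  have hcol : ∀ l, (blkIncl n l)ᵀ * y * J ∈ extV V l m := fun l => by
    rcases le_or_gt m l with h | h
    · rw [← blk_eq]
      exact hblk l m h
    · rw [hzero l h, Matrix.zero_mul]
      exact zero_mem _
  have hcpos : 0 < c := by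
    set e : Fin (n m) → ℝ := Pi.single ⟨0, (n m).2⟩ 1 with he
    have hJe : Jᵀ *ᵥ (J *ᵥ e) = e := by rw [Matrix.mulVec_mulVec, hJJ, Matrix.one_mulVec]
    have h1 := hpos (J *ᵥ e) (fun h => by
      rw [h, Matrix.mulVec_zero] at hJe
      have := congrFun hJe ⟨0, (n m).2⟩
      simp [he] at this) (fun k hk => by
        rw [Matrix.mulVec_mulVec, blkIncl_transpose_mul_of_ne hk.ne, Matrix.zero_mulVec])
    rw [dotProduct_mulVec_comm, Matrix.mulVec_mulVec, Matrix.mulVec_mulVec, hc, Matrix.smul_mulVec,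
      Matrix.one_mulVec] at h1
    simpa [he] using h1
  have hsq : (√c)⁻¹ * (√c)⁻¹ = c⁻¹ := by
    rw [← mul_inv, Real.mul_self_sqrt hcpos.le]
  have hne : c ≠ 0 := hcpos.ne'
  refine ⟨(√c)⁻¹ • (y * J * Jᵀ), y - c⁻¹ • ((y * J) * (y * J)ᵀ), ?_, ?_, ?_, ?_, ?_, ?_, ?_⟩
  · have : (y * J * Jᵀ) * (y * J * Jᵀ)ᵀ = (y * J) * (y * J)ᵀ := by
      rw [Matrix.transpose_mul (y * J), Matrix.transpose_transpose, Matrix.mul_assoc (y * J),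
        ← Matrix.mul_assoc Jᵀ, hJJ, Matrix.one_mul]
    rw [Matrix.transpose_smul, Matrix.smul_mul, Matrix.mul_smul, smul_smul, this, hsq,
      add_sub_cancel]
  · intro l k
    rw [blk_eq, Matrix.mul_smul, Matrix.smul_mul]
    refine Submodule.smul_mem _ _ ?_
    rw [← Matrix.mul_assoc, ← Matrix.mul_assoc, Matrix.mul_assoc _ Jᵀ]
    rcases eq_or_ne m k with rfl | h
    · rw [hJJ, Matrix.mul_one]
      exact hcol l
    · rw [blkIncl_transpose_mul_of_ne h, Matrix.mul_zero]
      exact zero_mem _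
  · have : blk ((√c)⁻¹ • (y * J * Jᵀ)) m m = ((√c)⁻¹ * c) • 1 := by
      rw [blk_eq, Matrix.mul_smul, Matrix.smul_mul, ← Matrix.mul_assoc, ← Matrix.mul_assoc,
        Matrix.mul_assoc _ Jᵀ, ← hJ, hJJ, Matrix.mul_one, hc, smul_smul]
    rw [tdiag_eq this]
    positivity
  · intro k hk
    rw [Matrix.smul_mul, Matrix.mul_assoc, blkIncl_transpose_mul_of_ne hk.symm, Matrix.mul_zero,
      smul_zero]
  · refine mem_Zspace.2 ⟨hsymm.sub (IsSymm.smul (show _ᵀ = _ by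
        rw [Matrix.transpose_mul, Matrix.transpose_transpose]) _),
      fun l k hkl => ?_⟩
    have h : blk (y - c⁻¹ • ((y * J) * (y * J)ᵀ)) l k =
        blk y l k - c⁻¹ • (((blkIncl n l)ᵀ * y * J) * ((blkIncl n k)ᵀ * y * J)ᵀ) := by
      simp only [blk_eq, Matrix.mul_sub, Matrix.sub_mul, Matrix.mul_smul, Matrix.smul_mul,
        Matrix.transpose_mul, Matrix.transpose_transpose, Matrix.mul_assoc]
    rw [h]
    refine sub_mem (hblk l k hkl) (Submodule.smul_mem _ _ ?_)
    rcases hkl.lt_or_eq with hkl | rfl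
    · exact mul_transpose_mem_extV hV2 hkl (hcol l) (hcol k)
    · exact mul_transpose_self_mem_extV hV3 (hcol k)
  · intro k hk
    rw [Matrix.mul_sub, Matrix.mul_smul, ← Matrix.mul_assoc, ← Matrix.mul_assoc]
    rcases hk.lt_or_eq with hk | rfl
    · simp [hzero k hk]
    · rw [hc, Matrix.smul_mul, smul_smul, inv_mul_cancel₀ hne, one_smul, Matrix.one_mul,
        Matrix.transpose_mul, hsymm', sub_self]
  · intro v hv hvk
    set p := Jᵀ *ᵥ (y *ᵥ v) with hp
    set w := c⁻¹ • p with hw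
    have hJw : Jᵀ *ᵥ (J *ᵥ w) = w := by rw [Matrix.mulVec_mulVec, hJJ, Matrix.one_mulVec]
    have h1 := hpos (v - J *ᵥ w) (fun h => by
      rw [sub_eq_zero] at h
      rw [← h, hvk m le_rfl] at hJw
      rw [← hJw, Matrix.mulVec_zero] at h
      exact hv h) (fun k hk => by
        rw [Matrix.mulVec_sub, hvk k hk.le, Matrix.mulVec_mulVec,
          blkIncl_transpose_mul_of_ne hk.ne, Matrix.zero_mulVec, sub_zero])
    have h2 : v ⬝ᵥ (y *ᵥ (J *ᵥ w)) = p ⬝ᵥ w := by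
      rw [dotProduct_comm, dotProduct_mulVec_comm, hsymm', dotProduct_mulVec_comm,
        dotProduct_comm]
    have h3 : (J *ᵥ w) ⬝ᵥ (y *ᵥ v) = p ⬝ᵥ w := by
      rw [dotProduct_mulVec_comm, dotProduct_comm]
    have h4 : (J *ᵥ w) ⬝ᵥ (y *ᵥ (J *ᵥ w)) = p ⬝ᵥ w := by
      rw [dotProduct_mulVec_comm, Matrix.mulVec_mulVec, Matrix.mulVec_mulVec, hc,
        Matrix.smul_mulVec, Matrix.one_mulVec, hw, smul_smul,
        mul_inv_cancel₀ hne, one_smul, dotProduct_comm]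
    have h5 : v ⬝ᵥ ((c⁻¹ • ((y * J) * (y * J)ᵀ)) *ᵥ v) = p ⬝ᵥ w := by
      rw [Matrix.smul_mulVec, ← Matrix.mulVec_mulVec, Matrix.transpose_mul, hsymm',
        ← Matrix.mulVec_mulVec, ← Matrix.mulVec_mulVec, ← hp, dotProduct_smul, dotProduct_comm,
        dotProduct_mulVec_comm, hsymm', dotProduct_mulVec_comm, ← hp, hw, dotProduct_smul]
    rw [Matrix.mulVec_sub, sub_dotProduct, dotProduct_sub, dotProduct_sub, h2, h3, h4] at h1
    rw [Matrix.sub_mulVec, dotProduct_sub, h5]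
    linarith

theorem exists_eq_mul_transpose (hV2 : CondV2 V) (hV3 : CondV3 V) {x : Mat r n}
    (hx : x ∈ Pcone V) : ∃ T ∈ Hgrp V, x = T * Tᵀ := by
  have key : ∀ m ≤ r + 1, ∃ T y : Mat r n, x = T * Tᵀ + y ∧ T ∈ triSpace V ∧
      (∀ k : Fin (r + 1), (k : ℕ) < m → 0 < tdiag T k) ∧
      (∀ k : Fin (r + 1), m ≤ k → T * blkIncl n k = 0) ∧ y ∈ Zspace V ∧
      (∀ k : Fin (r + 1), (k : ℕ) < m → (blkIncl n k)ᵀ * y = 0) ∧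
      ∀ v : Idx r n → ℝ, v ≠ 0 → (∀ k : Fin (r + 1), (k : ℕ) < m → (blkIncl n k)ᵀ *ᵥ v = 0) →
        0 < v ⬝ᵥ (y *ᵥ v) := by
    intro m
    induction m with
    | zero =>
      intro _
      refine ⟨0, x, by simp, zero_mem _, by simp, by simp, hx.1, by simp, fun v hv _ => ?_⟩
      simpa using hx.2.dotProduct_mulVec_pos hv
    | succ m ih =>
      intro hm
      obtain ⟨T, y, hxy, hT, hTpos, hTz, hy, hyz, hypos⟩ := ih (by omega)
      obtain ⟨S, y', hyS, hS, hSpos, hSz, hy', hyz', hypos'⟩ :=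
        exists_elimination_step hV2 hV3 hy ⟨m, by omega⟩ (fun k hk => hyz k hk)
          (fun v hv h => hypos v hv (fun k hk => h k hk))
      have hTS : T * Sᵀ = 0 := by
        rw [mul_eq_sum_blkIncl]
        refine Finset.sum_eq_zero fun k _ => ?_
        rcases eq_or_ne k ⟨m, by omega⟩ with rfl | hk
        · rw [hTz _ le_rfl, Matrix.zero_mul]
        · rw [← Matrix.transpose_mul, hSz k hk, Matrix.transpose_zero, Matrix.mul_zero]
      have hST : S * Tᵀ = 0 := by
        rw [← Matrix.transpose_transpose (S * Tᵀ), Matrix.transpose_mul,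
          Matrix.transpose_transpose, hTS, Matrix.transpose_zero]
      refine ⟨T + S, y', ?_, add_mem hT hS, fun k hk => ?_, fun k hk => ?_, hy',
        fun k hk => hyz' k (Nat.lt_succ_iff.1 hk),
        fun v hv h => hypos' v hv fun k hk => h k (Nat.lt_succ_iff.2 hk)⟩
      · rw [Matrix.transpose_add, Matrix.add_mul, Matrix.mul_add, Matrix.mul_add, hTS, hST, hxy,
          hyS]
        abel
      · rw [tdiag_eq_mul_blkIncl, Matrix.add_mul, Matrix.add_apply, ← tdiag_eq_mul_blkIncl,
          ← tdiag_eq_mul_blkIncl]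
        rcases (Nat.lt_succ_iff.1 hk).lt_or_eq with h | h
        · rw [tdiag_eq_mul_blkIncl S, hSz k (fun h' => by simp [h'] at h), Matrix.zero_apply,
            add_zero]
          exact hTpos k h
        · have h' : k = ⟨m, by omega⟩ := Fin.ext h
          rw [h', tdiag_eq_mul_blkIncl T, hTz _ le_rfl, Matrix.zero_apply, zero_add]
          exact hSpos
      · rw [Matrix.add_mul, hTz k (by omega), hSz k (fun h' => by simp [h'] at hk), add_zero]
  obtain ⟨T, y, hxy, hT, hTpos, -, -, hyz, -⟩ := key (r + 1) le_rfl
  have hy : y = 0 := by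
    rw [← Matrix.one_mul y, mul_eq_sum_blkIncl]
    exact Finset.sum_eq_zero fun k _ => by rw [hyz k k.2, Matrix.mul_zero]
  exact ⟨T, mem_Hgrp.2 ⟨hT, fun k => hTpos k k.2⟩, by rw [hxy, hy, add_zero]⟩

theorem trace_mul_transpose_comm {m m' : Type*} [Fintype m] [Fintype m'] (X Y : Matrix m m' ℝ) :
    (X * Yᵀ).trace = (Y * Xᵀ).trace := by
  rw [← Matrix.trace_transpose, Matrix.transpose_mul, Matrix.transpose_transpose]

theorem exists_orthonormal_family {m m' : Type*} [Fintype m] [Fintype m']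
    (S : Submodule ℝ (Matrix m m' ℝ)) :
    ∃ (d : ℕ) (R : Fin d → Matrix m m' ℝ), (∀ a, R a ∈ S) ∧
      (∀ a b, (R a * (R b)ᵀ).trace = if a = b then 1 else 0) ∧
      ∀ X ∈ S, X = ∑ s, (X * (R s)ᵀ).trace • R s := by
  classical
  let e : Matrix m m' ℝ ≃ₗ[ℝ] EuclideanSpace ℝ (m × m') :=
    (LinearEquiv.curry ℝ ℝ m m').symm.trans (WithLp.linearEquiv 2 ℝ (m × m' → ℝ)).symm
  have he : ∀ X Y : Matrix m m' ℝ, inner ℝ (e X) (e Y) = (X * Yᵀ).trace := fun X Y => by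
    rw [PiLp.inner_apply, Fintype.sum_prod_type]
    simp only [Matrix.trace, Matrix.diag, Matrix.mul_apply, Matrix.transpose_apply]
    refine Finset.sum_congr rfl fun a _ => Finset.sum_congr rfl fun b _ => ?_
    exact mul_comm _ _
  let S' : Submodule ℝ (EuclideanSpace ℝ (m × m')) := S.map e.toLinearMap
  let b := stdOrthonormalBasis ℝ S'
  have hR : ∀ s, e (e.symm (b s : EuclideanSpace ℝ (m × m'))) = b s :=
    fun s => e.apply_symm_apply _
  refine ⟨Module.finrank ℝ S', fun s => e.symm (b s), fun s => ?_, fun s t => ?_, fun X hX => ?_⟩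
  · obtain ⟨X, hX, h⟩ := (b s).2
    show e.symm (b s : EuclideanSpace ℝ (m × m')) ∈ S
    rw [← h]
    exact (e.symm_apply_apply X).symm ▸ hX
  · rw [← he, hR, hR, ← Submodule.coe_inner, orthonormal_iff_ite.1 b.orthonormal]
  · apply e.injective
    have h := b.sum_repr' ⟨e X, X, hX, rfl⟩
    have h' := congrArg Subtype.val h
    rw [map_sum]
    simp only [Submodule.coe_sum, Submodule.coe_smul, Submodule.coe_inner] at h'
    rw [← h']
    refine Finset.sum_congr rfl fun s _ => ?_
    rw [map_smul, hR, ← he, hR, real_inner_comm]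

theorem sum_trace_mul_trace {m m' : Type*} [Fintype m] [Fintype m'] {d : ℕ}
    {R : Fin d → Matrix m m' ℝ} {X : Matrix m m' ℝ}
    (hX : X = ∑ s, (X * (R s)ᵀ).trace • R s) (Y : Matrix m m' ℝ) :
    ∑ s, (X * (R s)ᵀ).trace * (R s * Yᵀ).trace = (X * Yᵀ).trace := by
  conv_rhs => rw [hX]
  rw [Matrix.sum_mul, Matrix.trace_sum]
  simp only [Matrix.smul_mul, Matrix.trace_smul, smul_eq_mul]

theorem exists_trace_projection {m m' : Type*} [Fintype m] [Fintype m']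
    (S : Submodule ℝ (Matrix m m' ℝ)) (Y : Matrix m m' ℝ) :
    ∃ C ∈ S, ∀ X ∈ S, (C * Xᵀ).trace = (Y * Xᵀ).trace := by
  obtain ⟨d, R, hR, -, hexp⟩ := exists_orthonormal_family S
  refine ⟨∑ s, (Y * (R s)ᵀ).trace • R s, sum_mem fun s _ => Submodule.smul_mem _ _ (hR s),
    fun X hX => ?_⟩
  rw [trace_mul_transpose_comm Y, ← sum_trace_mul_trace (hexp X hX), Matrix.sum_mul,
    Matrix.trace_sum]
  refine Finset.sum_congr rfl fun s _ => ?_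
  rw [Matrix.smul_mul, Matrix.trace_smul, smul_eq_mul, trace_mul_transpose_comm Y,
    trace_mul_transpose_comm X, mul_comm]

variable (V) in
/-- Orthonormal bases of the spaces of block rows, listed in reverse order of the blocks. -/
structure RowBasis (nt : Fin (r + 1) → ℕ+) where
  /-- The basis vectors. -/
  vec (k : Fin (r + 1)) : Fin (nt k) → Matrix (Fin (n k.rev)) (Idx r n) ℝ
  mem (k : Fin (r + 1)) (a : Fin (nt k)) : vec k a ∈ rowSpace V k.rev
  orth (k : Fin (r + 1)) (a b : Fin (nt k)) :
    (vec k a * (vec k b)ᵀ).trace = if a = b then 1 else 0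
  expand (k : Fin (r + 1)) (X : Matrix (Fin (n k.rev)) (Idx r n) ℝ) (hX : X ∈ rowSpace V k.rev) :
    X = ∑ s, (X * (vec k s)ᵀ).trace • vec k s

theorem blkIncl_transpose_mem_rowSpace (l : Fin (r + 1)) : (blkIncl n l)ᵀ ∈ rowSpace V l := by
  have := blkIncl_transpose_mul_mem_rowSpace (V := V) one_mem_triSpace l
  rwa [Matrix.mul_one] at this

variable (V) in
theorem exists_rowBasis : ∃ nt : Fin (r + 1) → ℕ+, Nonempty (RowBasis V nt) := by
  choose d R hR horth hexp using fun k : Fin (r + 1) => exists_orthonormal_family (rowSpace V k)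
  have hd : ∀ k, 0 < d k := fun k => by
    rcases Nat.eq_zero_or_pos (d k) with h | h
    · exfalso
      have h1 := hexp k _ (blkIncl_transpose_mem_rowSpace k)
      have : IsEmpty (Fin (d k)) := by
        rw [h]
        infer_instance
      rw [Finset.univ_eq_empty, Finset.sum_empty] at h1
      have h2 := blkIncl_transpose_mul_self (n := n) k
      rw [h1, Matrix.zero_mul] at h2
      have h3 := congrFun (congrFun h2 ⟨0, (n k).2⟩) ⟨0, (n k).2⟩
      simp at h3
    · exact h
  exact ⟨fun k => ⟨d k.rev, hd _⟩, ⟨⟨fun k => R k.rev, fun k => hR _, fun k => horth _,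
    fun k => hexp _⟩⟩⟩

namespace RowBasis

variable {nt : Fin (r + 1) → ℕ+} (R : RowBasis V nt)

/-- The adjoint of left multiplication by a block, as a matrix in the bases `R`. -/
def dualBlk (l k : Fin (r + 1)) :
    Matrix (Fin (n k.rev)) (Fin (n l.rev)) ℝ →ₗ[ℝ] Matrix (Fin (nt l)) (Fin (nt k)) ℝ where
  toFun A := Matrix.of fun a b => (A * R.vec l a * (R.vec k b)ᵀ).trace
  map_add' A B := by
    ext a b
    simp [Matrix.add_mul]
  map_smul' c A := by
    ext a b
    simp

theorem dualBlk_apply (l k : Fin (r + 1)) (A : Matrix (Fin (n k.rev)) (Fin (n l.rev)) ℝ)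
    (a : Fin (nt l)) (b : Fin (nt k)) :
    R.dualBlk l k A a b = (A * R.vec l a * (R.vec k b)ᵀ).trace := rfl

theorem dualBlk_mul (hV1 : CondV1 V) {l k i : Fin (r + 1)}
    {A : Matrix (Fin (n k.rev)) (Fin (n l.rev)) ℝ} (hA : A ∈ extV V k.rev l.rev)
    (B : Matrix (Fin (n i.rev)) (Fin (n k.rev)) ℝ) :
    R.dualBlk l k A * R.dualBlk k i B = R.dualBlk l i (B * A) := by
  ext a b
  have h : ∀ s, (B * R.vec k s * (R.vec i b)ᵀ).trace =
      (R.vec k s * (Bᵀ * R.vec i b)ᵀ).trace := fun s => by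
    rw [Matrix.transpose_mul, Matrix.transpose_transpose, Matrix.mul_assoc, Matrix.trace_mul_comm,
      Matrix.mul_assoc]
  simp only [Matrix.mul_apply, dualBlk_apply, h]
  rw [sum_trace_mul_trace (R.expand k _ (mul_mem_rowSpace hV1 hA (R.mem l a))),
    Matrix.transpose_mul, Matrix.transpose_transpose, ← Matrix.mul_assoc, Matrix.trace_mul_comm]
  simp only [Matrix.mul_assoc]

theorem dualBlk_mul_transpose (hV1 : CondV1 V) {l k i : Fin (r + 1)}
    {A : Matrix (Fin (n i.rev)) (Fin (n l.rev)) ℝ} (hA : A ∈ extV V i.rev l.rev)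
    (B : Matrix (Fin (n i.rev)) (Fin (n k.rev)) ℝ) :
    R.dualBlk l i A * (R.dualBlk k i B)ᵀ = R.dualBlk l k (Bᵀ * A) := by
  ext a b
  simp only [Matrix.mul_apply, Matrix.transpose_apply, dualBlk_apply]
  simp only [trace_mul_transpose_comm (B * R.vec k b)]
  rw [sum_trace_mul_trace (R.expand i _ (mul_mem_rowSpace hV1 hA (R.mem l a))),
    Matrix.transpose_mul, ← Matrix.mul_assoc, Matrix.trace_mul_comm]
  simp only [Matrix.mul_assoc]

theorem dualBlk_smul_one (l : Fin (r + 1)) (c : ℝ) : R.dualBlk l l (c • 1) = c • 1 := by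
  ext a b
  rw [dualBlk_apply, Matrix.smul_mul, Matrix.one_mul, Matrix.smul_mul, Matrix.trace_smul, R.orth,
    Matrix.smul_apply, Matrix.one_apply]

theorem dualBlk_mul_transpose_self (hV1 : CondV1 V) (hV3 : CondV3 V) {l k : Fin (r + 1)}
    {A : Matrix (Fin (n k.rev)) (Fin (n l.rev)) ℝ} (hA : A ∈ extV V k.rev l.rev) :
    R.dualBlk l k A * (R.dualBlk l k A)ᵀ = ((A * Aᵀ).trace / (n l.rev : ℕ)) • 1 := by
  rw [dualBlk_mul_transpose R hV1 hA]
  ext a b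
  obtain ⟨c, hc⟩ := mem_extV_self.1 (polar_mem_of_rowSpace hV3 (R.mem l a) (R.mem l b))
  have hn : ((n l.rev : ℕ) : ℝ) ≠ 0 := by positivity
  have h1 := congrArg Matrix.trace hc
  rw [Matrix.trace_add, R.orth, R.orth, Matrix.trace_smul, Matrix.trace_one, Fintype.card_fin,
    smul_eq_mul] at h1
  have h2 := congrArg (fun M => (A * M * Aᵀ).trace) hc
  simp only [Matrix.mul_add, Matrix.add_mul, Matrix.trace_add, Matrix.mul_smul, Matrix.smul_mul,
    Matrix.trace_smul, Matrix.mul_one, smul_eq_mul] at h2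
  have h3 : (A * (R.vec l b * (R.vec l a)ᵀ) * Aᵀ).trace =
      (A * (R.vec l a * (R.vec l b)ᵀ) * Aᵀ).trace := by
    rw [← Matrix.trace_transpose]
    simp only [Matrix.transpose_mul, Matrix.transpose_transpose, Matrix.mul_assoc]
  have h4 : (Aᵀ * A * R.vec l a * (R.vec l b)ᵀ).trace =
      (A * (R.vec l a * (R.vec l b)ᵀ) * Aᵀ).trace := by
    rw [Matrix.trace_mul_comm _ Aᵀ]
    simp only [Matrix.mul_assoc]
  rw [dualBlk_apply, h4, Matrix.smul_apply, Matrix.one_apply, smul_eq_mul]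
  rw [h3] at h2
  rcases eq_or_ne a b with rfl | hab
  · simp only [if_true] at h1 ⊢
    field_simp
    have : c = 2 / (n l.rev : ℕ) := by
      field_simp
      linarith
    rw [this] at h2
    field_simp at h2
    linarith
  · simp only [hab, hab.symm, if_false, add_zero] at h1 ⊢
    have : c = 0 := by simpa [hn] using h1.symm
    rw [this] at h2
    linarith

theorem dualBlk_eq_zero (hV1 : CondV1 V) (hV3 : CondV3 V) {l k : Fin (r + 1)}
    {A : Matrix (Fin (n k.rev)) (Fin (n l.rev)) ℝ} (hA : A ∈ extV V k.rev l.rev)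
    (h : R.dualBlk l k A = 0) : A = 0 := by
  have h1 := R.dualBlk_mul_transpose_self hV1 hV3 hA
  rw [h, Matrix.zero_mul] at h1
  have h2 := congrFun (congrFun h1 ⟨0, (nt l).2⟩) ⟨0, (nt l).2⟩
  rw [Matrix.zero_apply, Matrix.smul_apply, Matrix.one_apply_eq, smul_eq_mul, mul_one, eq_comm,
    div_eq_zero_iff] at h2
  have h3 : (A * Aᴴ).trace = 0 := by
    rcases h2 with h2 | h2
    · exact h2
    · exact absurd h2 (by positivity)
  exact Matrix.trace_mul_conjTranspose_self_eq_zero_iff.1 h3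

/-- The dual family. -/
def dualV (l k : Fin (r + 1)) : Submodule ℝ (Matrix (Fin (nt l)) (Fin (nt k)) ℝ) :=
  (V k.rev l.rev).map (R.dualBlk l k)

theorem mem_extV_dualV {l k : Fin (r + 1)} {B : Matrix (Fin (nt l)) (Fin (nt k)) ℝ} :
    B ∈ extV R.dualV l k ↔ ∃ A ∈ extV V k.rev l.rev, R.dualBlk l k A = B := by
  rcases lt_trichotomy l k with h | rfl | h
  · simp only [mem_extV_of_gt h, mem_extV_of_gt (Fin.rev_lt_rev.2 h)]
    exact ⟨fun hB => ⟨0, rfl, by rw [map_zero, hB]⟩, by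
      rintro ⟨A, rfl, rfl⟩
      exact map_zero _⟩
  · simp only [mem_extV_self]
    constructor
    · rintro ⟨c, rfl⟩
      exact ⟨_, ⟨c, rfl⟩, R.dualBlk_smul_one l c⟩
    · rintro ⟨_, ⟨c, rfl⟩, rfl⟩
      exact ⟨c, R.dualBlk_smul_one l c⟩
  · simp only [mem_extV_of_lt h, mem_extV_of_lt (Fin.rev_lt_rev.2 h)]
    exact Submodule.mem_map

theorem condV1_dualV (hV1 : CondV1 V) : CondV1 R.dualV := by
  rintro i k l hik hkl _ ⟨A, hA, rfl⟩ _ ⟨B, hB, rfl⟩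
  rw [← Fin.rev_lt_rev] at hik hkl
  rw [R.dualBlk_mul hV1 ((mem_extV_of_lt hkl).2 hA)]
  exact ⟨_, hV1 _ _ _ hkl hik B hB A hA, rfl⟩

theorem condV2_dualV (hV1 : CondV1 V) (hV2 : CondV2 V) : CondV2 R.dualV := by
  rintro i k l hik hkl _ ⟨A, hA, rfl⟩ _ ⟨B, hB, rfl⟩
  rw [← Fin.rev_lt_rev] at hik hkl
  rw [R.dualBlk_mul_transpose hV1 ((mem_extV_of_lt (hkl.trans hik)).2 hA)]
  obtain ⟨C, hC, hproj⟩ := exists_trace_projection (V k.rev l.rev) (Bᵀ * A)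
  refine ⟨C, hC, ?_⟩
  ext a b
  have h := hproj _ ((mem_extV_of_lt hkl).1
    (mul_transpose_mem_of_rowSpace hV2 hkl (R.mem k b) (R.mem l a)))
  rw [Matrix.transpose_mul, Matrix.transpose_transpose, ← Matrix.mul_assoc,
    ← Matrix.mul_assoc] at h
  exact h

theorem condV3_dualV (hV1 : CondV1 V) (hV3 : CondV3 V) : CondV3 R.dualV := by
  rintro k l hkl _ ⟨A, hA, rfl⟩
  exact ⟨_, R.dualBlk_mul_transpose_self hV1 hV3
    ((mem_extV_of_lt (Fin.rev_lt_rev.2 hkl)).2 hA)⟩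

theorem finrank_dualV (hV1 : CondV1 V) (hV3 : CondV3 V) {l k : Fin (r + 1)} (hkl : k < l) :
    Module.finrank ℝ (R.dualV l k) = Module.finrank ℝ (V k.rev l.rev) := by
  have h : Function.Injective ((R.dualBlk l k).comp (V k.rev l.rev).subtype) := by
    rw [← LinearMap.ker_eq_bot, LinearMap.ker_eq_bot']
    intro A hA
    exact Subtype.ext (R.dualBlk_eq_zero hV1 hV3
      ((mem_extV_of_lt (Fin.rev_lt_rev.2 hkl)).2 A.2) hA)
  rw [← LinearMap.finrank_range_of_inj h, LinearMap.range_comp, Submodule.range_subtype]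
  rfl

/-- The basis vector `R.vec k a` as a block row of a block lower triangular matrix. -/
def basisMat (p : Idx r nt) : Mat r n := blkIncl n p.1.rev * R.vec p.1 p.2

theorem basisMat_mem_triSpace (p : Idx r nt) : R.basisMat p ∈ triSpace V := fun l k => by
  rw [blk_eq, basisMat, ← Matrix.mul_assoc, Matrix.mul_assoc _ (R.vec _ _)]
  rcases eq_or_ne l p.1.rev with rfl | h
  · rw [blkIncl_transpose_mul_self, Matrix.one_mul]
    exact R.mem p.1 p.2 k
  · rw [blkIncl_transpose_mul_of_ne h, Matrix.zero_mul]
    exact zero_mem _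

/-- The linear map sending the form `u ↦ ⟨X, u uᵀ⟩` to its matrix in the basis `R`. -/
def dualMap : Mat r n →ₗ[ℝ] Mat r nt where
  toFun X := Matrix.of fun p q => (X * R.basisMat p * (R.basisMat q)ᵀ).trace
  map_add' X Y := by
    ext p q
    simp [Matrix.add_mul]
  map_smul' c X := by
    ext p q
    simp

theorem dualMap_apply (X : Mat r n) (p q : Idx r nt) :
    R.dualMap X p q = (X * R.basisMat p * (R.basisMat q)ᵀ).trace := rfl

theorem blk_dualMap (X : Mat r n) (l k : Fin (r + 1)) :
    blk (R.dualMap X) l k = R.dualBlk l k (blk X k.rev l.rev) := by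
  ext a b
  have h : blk (R.dualMap X) l k a b = (X * (blkIncl n l.rev * R.vec l a) *
    (blkIncl n k.rev * R.vec k b)ᵀ).trace := rfl
  rw [h, dualBlk_apply, blk_eq, Matrix.transpose_mul, ← Matrix.mul_assoc, Matrix.trace_mul_comm]
  simp only [Matrix.mul_assoc]

theorem dualMap_transpose (X : Mat r n) : R.dualMap Xᵀ = (R.dualMap X)ᵀ := by
  ext p q
  rw [Matrix.transpose_apply, dualMap_apply, dualMap_apply, trace_mul_transpose_comm,
    Matrix.trace_mul_comm, Matrix.transpose_mul, Matrix.transpose_transpose, Matrix.trace_mul_comm,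
    ← Matrix.mul_assoc, Matrix.trace_mul_comm, ← Matrix.mul_assoc]

theorem dualMap_one : R.dualMap 1 = 1 := by
  refine ext_blk fun l k => ?_
  rw [blk_dualMap]
  rcases eq_or_ne l k with rfl | h
  · rw [blk_one_self, blk_one_self]
    simpa using R.dualBlk_smul_one l 1
  · rw [blk_one_of_ne h, blk_one_of_ne fun h' => h (Fin.rev_injective h').symm, map_zero]

theorem dualMap_mul_transpose (hV1 : CondV1 V) {T : Mat r n} (hT : T ∈ triSpace V) :
    R.dualMap T * (R.dualMap T)ᵀ = R.dualMap (Tᵀ * T) := by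
  refine ext_blk fun l k => ?_
  rw [blk_mul, blk_dualMap, blk_mul, map_sum, ← Equiv.sum_comp Fin.revPerm]
  refine Finset.sum_congr rfl fun i _ => ?_
  obtain ⟨i, rfl⟩ := Fin.rev_surjective i
  rw [Fin.revPerm_apply, Fin.rev_rev, blk_transpose, blk_transpose, blk_dualMap, blk_dualMap]
  exact R.dualBlk_mul_transpose hV1 (hT _ _) _

theorem dualMap_mem_triSpace {T : Mat r n} (hT : T ∈ triSpace V) :
    R.dualMap T ∈ triSpace R.dualV := fun l k => by
  rw [blk_dualMap]
  exact R.mem_extV_dualV.2 ⟨_, hT _ _, rfl⟩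

theorem dualMap_mem_Zspace {x : Mat r n} (hx : x ∈ Zspace V) :
    R.dualMap x ∈ Zspace R.dualV := by
  rw [mem_Zspace] at hx ⊢
  refine ⟨?_, fun l k h => ?_⟩
  · rw [Matrix.IsSymm, ← dualMap_transpose, hx.1.eq]
  · rw [blk_dualMap]
    exact R.mem_extV_dualV.2 ⟨_, hx.2 _ _ (Fin.rev_le_rev.2 h), rfl⟩

theorem tdiag_dualMap {T : Mat r n} (hT : T ∈ triSpace V) (k : Fin (r + 1)) :
    tdiag (R.dualMap T) k = tdiag T k.rev := by
  obtain ⟨c, hc⟩ := mem_extV_self.1 (hT k.rev k.rev)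
  rw [tdiag_eq hc, tdiag_eq]
  rw [blk_dualMap, hc, dualBlk_smul_one]

theorem dualMap_mem_Hgrp {T : Mat r n} (hT : T ∈ triSpace V) :
    R.dualMap T ∈ Hgrp R.dualV ↔ T ∈ Hgrp V := by
  simp only [mem_Hgrp, R.dualMap_mem_triSpace hT, hT, true_and, R.tdiag_dualMap hT]
  exact ⟨fun h k => by simpa using h k.rev, fun h k => h k.rev⟩

theorem exists_blk_rev_eq
    (A : ∀ l k : Fin (r + 1), Matrix (Fin (n k.rev)) (Fin (n l.rev)) ℝ) :
    ∃ X : Mat r n, ∀ l k, blk X k.rev l.rev = A l k := by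
  let X : Mat r n := Matrix.of fun p q =>
    A q.1.rev p.1.rev (Fin.cast (by rw [Fin.rev_rev]) p.2) (Fin.cast (by rw [Fin.rev_rev]) q.2)
  have hX : ∀ l k a b, blk X l k a b = A k.rev l.rev (Fin.cast (by rw [Fin.rev_rev]) a)
    (Fin.cast (by rw [Fin.rev_rev]) b) := fun _ _ _ _ => rfl
  refine ⟨X, fun l k => ?_⟩
  ext a b
  have h : ∀ l' k' (hl : l' = l) (hk : k' = k), A l' k' (Fin.cast (by rw [hk]) a)
    (Fin.cast (by rw [hl]) b) = A l k a b := by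
    rintro _ _ rfl rfl
    rfl
  exact h _ _ (Fin.rev_rev l) (Fin.rev_rev k)

theorem exists_dualMap_eq_of_triSpace {S : Mat r nt} (hS : S ∈ triSpace R.dualV) :
    ∃ T ∈ triSpace V, R.dualMap T = S := by
  choose A hA hAS using fun l k => R.mem_extV_dualV.1 (hS l k)
  obtain ⟨T, hT⟩ := exists_blk_rev_eq A
  refine ⟨T, fun k l => ?_, ext_blk fun l k => ?_⟩
  · obtain ⟨k, rfl⟩ := Fin.rev_surjective k
    obtain ⟨l, rfl⟩ := Fin.rev_surjective l
    rw [hT]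
    exact hA l k
  · rw [blk_dualMap, hT, hAS]

theorem exists_dualMap_eq_of_Zspace {y : Mat r nt} (hy : y ∈ Zspace R.dualV) :
    ∃ x ∈ Zspace V, R.dualMap x = y := by
  rw [mem_Zspace] at hy
  choose A hA hAy using fun l k (h : k ≤ l) => R.mem_extV_dualV.1 (hy.2 l k h)
  have hdiag : ∀ l, (A l l le_rfl)ᵀ = A l l le_rfl := fun l => by
    obtain ⟨c, hc⟩ := mem_extV_self.1 (hA l l le_rfl)
    rw [hc, Matrix.transpose_smul, Matrix.transpose_one]
  obtain ⟨x, hx⟩ := exists_blk_rev_eq (n := n)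
    fun l k => if h : k ≤ l then A l k h else (A k l (not_le.1 h).le)ᵀ
  have hlow : ∀ l k (h : k ≤ l), blk x k.rev l.rev = A l k h := fun l k h => by
    rw [hx, dif_pos h]
  have hsymm : x.IsSymm := by
    refine ext_blk fun k l => ?_
    obtain ⟨k, rfl⟩ := Fin.rev_surjective k
    obtain ⟨l, rfl⟩ := Fin.rev_surjective l
    rw [blk_transpose, hx, hx]
    rcases lt_trichotomy k l with h | rfl | h
    · rw [dif_neg h.not_ge, dif_pos h.le, Matrix.transpose_transpose]
    · rw [dif_pos le_rfl, hdiag]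
    · rw [dif_pos h.le, dif_neg h.not_ge]
  refine ⟨x, mem_Zspace.2 ⟨hsymm, fun k l h => ?_⟩, ext_blk fun l k => ?_⟩
  · obtain ⟨k, rfl⟩ := Fin.rev_surjective k
    obtain ⟨l, rfl⟩ := Fin.rev_surjective l
    rw [hlow l k (Fin.rev_le_rev.1 h)]
    exact hA _ _ _
  · rcases le_total k l with h | h
    · rw [blk_dualMap, hlow l k h, hAy]
    · rw [← hy.1.eq, ← hsymm.eq, dualMap_transpose, blk_transpose, blk_transpose, blk_dualMap,
        hlow k l h, hAy]

theorem dualMap_injOn (hV1 : CondV1 V) (hV3 : CondV3 V) : Set.InjOn R.dualMap (Zspace V) := by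
  have h0 : ∀ x ∈ Zspace V, R.dualMap x = 0 → x = 0 := fun x hx h => by
    rw [mem_Zspace] at hx
    have hlow : ∀ k l, l ≤ k → blk x k l = 0 := fun k l hkl => by
      obtain ⟨k, rfl⟩ := Fin.rev_surjective k
      obtain ⟨l, rfl⟩ := Fin.rev_surjective l
      refine R.dualBlk_eq_zero hV1 hV3 (hx.2 _ _ hkl) ?_
      rw [← blk_dualMap, h]
      rfl
    refine ext_blk fun k l => ?_
    rcases le_total l k with h | h
    · exact hlow k l h
    · rw [← hx.1.eq, blk_transpose, hlow l k h]
      rfl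
  intro x hx y hy h
  have hxy : x - y ∈ Zsub V := sub_mem hx hy
  exact sub_eq_zero.1 (h0 _ hxy (by rw [map_sub, h, sub_self]))

/-- The element of `triSpace V` with coordinates `v`. -/
def combo (v : Idx r nt → ℝ) : Mat r n := ∑ p, v p • R.basisMat p

theorem combo_mem_triSpace (v : Idx r nt → ℝ) : R.combo v ∈ triSpace V :=
  sum_mem fun p _ => Submodule.smul_mem _ _ (R.basisMat_mem_triSpace p)

theorem dotProduct_dualMap_mulVec (X : Mat r n) (v : Idx r nt → ℝ) :
    v ⬝ᵥ R.dualMap X *ᵥ v = tip X (R.combo v * (R.combo v)ᵀ) := by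
  rw [tip, ← Matrix.mul_assoc, combo, Matrix.transpose_sum, Matrix.mul_sum, Matrix.trace_sum]
  simp only [dotProduct, Matrix.mulVec, Finset.mul_sum]
  rw [Finset.sum_comm]
  refine Finset.sum_congr rfl fun q _ => ?_
  rw [Matrix.sum_mul, Matrix.trace_sum]
  refine Finset.sum_congr rfl fun p _ => ?_
  rw [Matrix.transpose_smul, Matrix.mul_smul, Matrix.mul_smul, Matrix.smul_mul, Matrix.trace_smul,
    Matrix.trace_smul, dualMap_apply]
  simp only [smul_eq_mul]
  ring

end RowBasis

theorem eq_of_dotProduct_mulVec_eq {m : Type*} [Fintype m] {A B : Matrix m m ℝ} (hA : A.IsSymm)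
    (hB : B.IsSymm) (h : ∀ v, v ⬝ᵥ A *ᵥ v = v ⬝ᵥ B *ᵥ v) : A = B := by
  classical
  have h0 : ∀ v, v ⬝ᵥ (A - B) *ᵥ v = 0 := fun v => by
    rw [Matrix.sub_mulVec, dotProduct_sub, h, sub_self]
  have hpsd : (A - B).PosSemidef :=
    .of_dotProduct_mulVec_nonneg (hA.sub hB) fun v => (h0 v).ge
  rw [← sub_eq_zero]
  refine Matrix.ext_of_mulVec_single fun i => ?_
  rw [(hpsd.dotProduct_mulVec_zero_iff _).1 (h0 _), Matrix.zero_mulVec]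

theorem isUnit_of_mem_Hgrp {T : Mat r n} (hT : T ∈ Hgrp V) : IsUnit T := by
  rw [Matrix.isUnit_iff_isUnit_det, isUnit_iff_ne_zero, ← Matrix.det_transpose]
  have htri : Tᵀ.BlockTriangular Sigma.fst := fun p q hpq =>
    congrFun (congrFun (hT.1 p.1 q.1 hpq) q.2) p.2
  rw [htri.det_fintype, Finset.prod_ne_zero_iff]
  intro k _
  obtain ⟨t, ht, htk⟩ := hT.2.2 k
  have : Tᵀ.toSquareBlock Sigma.fst k = t • 1 := by
    ext ⟨⟨i, a⟩, hi⟩ ⟨⟨j, b⟩, hj⟩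
    obtain rfl : i = k := hi
    obtain rfl : j = i := hj
    rw [Matrix.toSquareBlock_def, Matrix.of_apply, Matrix.transpose_apply, htk, Matrix.smul_apply,
      Matrix.one_apply]
    simp [eq_comm]
  rw [this, Matrix.det_smul, Matrix.det_one, mul_one]
  exact pow_ne_zero _ ht.ne'

theorem closure_Pcone_subset {x : Mat r n} (hx : x ∈ closure (Pcone V)) :
    x ∈ Zspace V ∧ x.PosSemidef := by
  have hclosed : IsClosed (Zspace V ∩ {x : Mat r n | ∀ v, 0 ≤ v ⬝ᵥ x *ᵥ v}) := by
    refine (Submodule.closed_of_finiteDimensional (Zsub V)).inter ?_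
    simp only [Set.ofPred_forall]
    refine isClosed_iInter fun v => isClosed_le continuous_const ?_
    fun_prop
  have hsub : Pcone V ⊆ Zspace V ∩ {x : Mat r n | ∀ v, 0 ≤ v ⬝ᵥ x *ᵥ v} := fun y hy =>
    ⟨hy.1, fun v => hy.2.posSemidef.dotProduct_mulVec_nonneg v⟩
  obtain ⟨h1, h2⟩ := closure_minimal hsub hclosed hx
  exact ⟨h1, .of_dotProduct_mulVec_nonneg h1.1 h2⟩

theorem mem_closure_Pcone {x : Mat r n} (hx : x ∈ Zspace V) (hpsd : x.PosSemidef) :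
    x ∈ closure (Pcone V) := by
  have hlim : Filter.Tendsto (fun ε : ℝ => x + ε • (1 : Mat r n)) (nhdsWithin 0 (Set.Ioi 0))
      (nhds x) := by
    have : Continuous fun ε : ℝ => x + ε • (1 : Mat r n) := by fun_prop
    simpa using (this.tendsto 0).mono_left nhdsWithin_le_nhds
  refine mem_closure_of_tendsto hlim (Filter.eventually_of_mem self_mem_nhdsWithin fun ε hε => ?_)
  exact ⟨(Zsub V).add_mem hx ((Zsub V).smul_mem ε one_mem_Zspace),
    Matrix.PosDef.posSemidef_add hpsd (Matrix.PosDef.one.smul hε)⟩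

theorem tip_one_rhoM (T x : Mat r n) : tip 1 (rhoM T x) = tip (Tᵀ * T) x := by
  rw [tip, tip, rhoM, Matrix.one_mul, Matrix.trace_mul_comm, Matrix.mul_assoc]

theorem mem_Qcone_of_tip {T ξ : Mat r n} (hT : T ∈ Hgrp V) (hξ : ξ ∈ Zspace V)
    (h : ∀ x ∈ Zspace V, tip ξ x = tip 1 (rhoM T x)) : ξ ∈ Qcone V := by
  refine ⟨hξ, fun x hx hx0 => ?_⟩
  obtain ⟨hxZ, hpsd⟩ := closure_Pcone_subset hx
  have hpsd' : (rhoM T x).PosSemidef := hpsd.mul_mul_conjTranspose_same T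
  rw [h x hxZ, tip, Matrix.one_mul]
  refine lt_of_le_of_ne hpsd'.trace_nonneg fun h0 => hx0 ?_
  have hzero : T * x * Tᵀ = 0 := hpsd'.trace_eq_zero_iff.1 h0.symm
  have hu := isUnit_of_mem_Hgrp hT
  rw [((Matrix.isUnit_transpose T).2 hu).mul_left_eq_zero, hu.mul_right_eq_zero] at hzero
  exact hzero

namespace RowBasis

variable {nt : Fin (r + 1) → ℕ+} (R : RowBasis V nt)

theorem dualMap_eq_mul_transpose (hV1 : CondV1 V) (hV2 : CondV2 V) (hV3 : CondV3 V)
    {T ξ : Mat r n} (hT : T ∈ triSpace V) (hξ : ξ ∈ Zspace V)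
    (h : ∀ x ∈ Zspace V, tip ξ x = tip 1 (rhoM T x)) :
    R.dualMap ξ = R.dualMap T * (R.dualMap T)ᵀ := by
  refine eq_of_dotProduct_mulVec_eq (R.dualMap_mem_Zspace hξ).1
    (Matrix.isSymm_mul_transpose_self _) fun v => ?_
  rw [R.dualMap_mul_transpose hV1 hT, dotProduct_dualMap_mulVec, dotProduct_dualMap_mulVec,
    h _ (mul_transpose_mem_Zspace hV2 hV3 (R.combo_mem_triSpace v)), tip_one_rhoM]

theorem posDef_dualMap (hV2 : CondV2 V) (hV3 : CondV3 V) {ξ : Mat r n} (hξ : ξ ∈ Qcone V) :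
    (R.dualMap ξ).PosDef := by
  refine .of_dotProduct_mulVec_pos (R.dualMap_mem_Zspace hξ.1).1 fun v hv => ?_
  have hmem := mul_transpose_mem_Zspace hV2 hV3 (R.combo_mem_triSpace v)
  have hpos : 0 < v ⬝ᵥ R.dualMap ξ *ᵥ v := by
    rw [dotProduct_dualMap_mulVec]
    refine hξ.2 _ (mem_closure_Pcone hmem (Matrix.posSemidef_self_mul_conjTranspose _))
      fun h0 => hv ?_
    have h1 := R.dotProduct_dualMap_mulVec 1 v
    rw [h0, dualMap_one, Matrix.one_mulVec, tip, Matrix.mul_zero, Matrix.trace_zero] at h1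
    exact dotProduct_self_eq_zero.1 h1
  exact hpos

theorem frakBound_dualV (hV1 : CondV1 V) (hV3 : CondV3 V) (ε : Fin (r + 1) → Bool)
    (k : Fin (r + 1)) : frakBound R.dualV ε k.rev = xiBound V (fun i => ε i.rev) k := by
  rw [frakBound, xiBound]
  congr 1
  refine Finset.sum_equiv Fin.revPerm (fun l => ?_) fun l hl => ?_
  · simp [Fin.rev_lt_iff]
  · rw [R.finrank_dualV hV1 hV3 (Finset.mem_filter.1 hl).2, Fin.revPerm_apply, Fin.rev_rev,
      Fin.rev_rev]

theorem mem_XiSet_iff (hV1 : CondV1 V) (hV3 : CondV3 V) (s : Fin (r + 1) → ℝ) :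
    s ∈ XiSet V ↔ (fun k => s k.rev) ∈ frakX R.dualV := by
  simp only [XiSet, frakX, Set.mem_iUnion, Set.mem_ofPred_eq]
  constructor
  · rintro ⟨ε, h⟩
    refine ⟨fun k => ε k.rev, fun k => ?_⟩
    obtain ⟨k, rfl⟩ := Fin.rev_surjective k
    rw [R.frakBound_dualV hV1 hV3]
    simpa using h k
  · rintro ⟨ε, h⟩
    refine ⟨fun k => ε k.rev, fun k => ?_⟩
    have hk := h k.rev
    rw [R.frakBound_dualV hV1 hV3] at hk
    simpa using hk

theorem chi_dualMap {T : Mat r n} (hT : T ∈ triSpace V) (s : Fin (r + 1) → ℝ) :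
    chi (fun k => s k.rev) (R.dualMap T) = chi s T := by
  rw [chi, chi, ← Equiv.prod_comp Fin.revPerm]
  refine Finset.prod_congr rfl fun k _ => ?_
  rw [R.tdiag_dualMap hT, Fin.revPerm_apply, Fin.rev_rev]

end RowBasis

/-- There exist a partition (`nt`) and a family `Vt` satisfying (V1)–(V3),
together with a linear isomorphism `l : 𝒵_Vt → 𝒵` such that `l(𝒫_Vt) = 𝒬` and
`Δ^Vt_{s*}(x) = δ_s(l(x))` for every `s` and every `x ∈ 𝒫_Vt`, where `s* = (s_r, …, s_1)`;
in this case `s ∈ Ξ` iff `s* ∈ 𝔛_Vt`. -/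
theorem statement14 (r : ℕ) (n : Fin (r + 1) → ℕ+)
    (V : ∀ l k : Fin (r + 1), Submodule ℝ (Matrix (Fin (n l)) (Fin (n k)) ℝ))
    (hV1 : CondV1 V) (hV2 : CondV2 V) (hV3 : CondV3 V)
    (rstar : Mat r n → Mat r n → Mat r n)
    (hrstar : ∀ T ∈ Hgrp V, ∀ ξ ∈ Zspace V, rstar T ξ ∈ Zspace V ∧
      ∀ x ∈ Zspace V, tip (rstar T ξ) x = tip ξ (rhoM T x))
    (δf : (Fin (r + 1) → ℝ) → Mat r n → ℝ)
    (hδ : ∀ s : Fin (r + 1) → ℝ, ∀ T ∈ Hgrp V, δf s (rstar T 1) = chi s T) :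
    ∃ (nt : Fin (r + 1) → ℕ+)
      (Vt : ∀ l k : Fin (r + 1), Submodule ℝ (Matrix (Fin (nt l)) (Fin (nt k)) ℝ)),
      CondV1 Vt ∧ CondV2 Vt ∧ CondV3 Vt ∧
      ∃ lmap : Mat r nt →ₗ[ℝ] Mat r n,
        Set.BijOn lmap (Zspace Vt) (Zspace V) ∧
        lmap '' Pcone Vt = Qcone V ∧
        (∀ (s : Fin (r + 1) → ℝ), ∀ x ∈ Pcone Vt,
          DeltaDef Vt (fun k => s k.rev) x = δf s (lmap x)) ∧
        (∀ s : Fin (r + 1) → ℝ, s ∈ XiSet V ↔ (fun k => s k.rev) ∈ frakX Vt) := by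
  obtain ⟨nt, ⟨R⟩⟩ := exists_rowBasis V
  have hinj := R.dualMap_injOn hV1 hV3
  obtain ⟨g, hg⟩ := (R.dualMap.comp (Zsub V).subtype).exists_leftInverse_of_injective
    (LinearMap.ker_eq_bot.2 fun x y h => Subtype.ext (hinj x.2 y.2 h))
  have hl : ∀ ξ ∈ Zspace V, (Zsub V).subtype (g (R.dualMap ξ)) = ξ := fun ξ hξ =>
    congrArg Subtype.val (LinearMap.congr_fun hg (⟨ξ, hξ⟩ : Zsub V))
  have hZ : ∀ T ∈ Hgrp V, rstar T 1 ∈ Zspace V := fun T hT => (hrstar T hT 1 one_mem_Zspace).1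
  have htip : ∀ T ∈ Hgrp V, ∀ x ∈ Zspace V, tip (rstar T 1) x = tip 1 (rhoM T x) := fun T hT =>
    (hrstar T hT 1 one_mem_Zspace).2
  have hstar : ∀ T ∈ Hgrp V, R.dualMap (rstar T 1) = R.dualMap T * (R.dualMap T)ᵀ := fun T hT =>
    R.dualMap_eq_mul_transpose hV1 hV2 hV3 (mem_Hgrp.1 hT).1 (hZ T hT) (htip T hT)
  have hH : ∀ S ∈ Hgrp R.dualV, ∃ T ∈ Hgrp V, R.dualMap T = S ∧
      S * Sᵀ = R.dualMap (rstar T 1) := fun S hS => by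
    obtain ⟨T, hT, rfl⟩ := R.exists_dualMap_eq_of_triSpace (mem_Hgrp.1 hS).1
    have hTH := (R.dualMap_mem_Hgrp hT).1 hS
    exact ⟨T, hTH, rfl, (hstar T hTH).symm⟩
  have hW2 := R.condV2_dualV hV1 hV2
  have hW3 := R.condV3_dualV hV1 hV3
  refine ⟨nt, R.dualV, R.condV1_dualV hV1, hW2, hW3, (Zsub V).subtype.comp g,
    ⟨fun y hy => ?_, fun y hy y' hy' h => ?_, fun ξ hξ => ⟨_, R.dualMap_mem_Zspace hξ, hl ξ hξ⟩⟩,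
    Set.Subset.antisymm ?_ fun ξ hξ => ⟨_, ⟨R.dualMap_mem_Zspace hξ.1,
      R.posDef_dualMap hV2 hV3 hξ⟩, hl ξ hξ.1⟩, fun s y hy => ?_, R.mem_XiSet_iff hV1 hV3⟩
  · exact (g y).2
  · obtain ⟨x, hx, rfl⟩ := R.exists_dualMap_eq_of_Zspace hy
    obtain ⟨x', hx', rfl⟩ := R.exists_dualMap_eq_of_Zspace hy'
    rw [LinearMap.comp_apply, LinearMap.comp_apply, hl x hx, hl x' hx'] at h
    rw [h]
  · rintro _ ⟨y, hy, rfl⟩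
    obtain ⟨S, hS, rfl⟩ := exists_eq_mul_transpose hW2 hW3 hy
    obtain ⟨T, hT, -, hTS⟩ := hH S hS
    rw [hTS, LinearMap.comp_apply, hl _ (hZ T hT)]
    exact mem_Qcone_of_tip hT (hZ T hT) (htip T hT)
  · have hex : ∃ S, S ∈ Hgrp R.dualV ∧ y = rhoM S 1 := by
      obtain ⟨S, hS, rfl⟩ := exists_eq_mul_transpose hW2 hW3 hy
      exact ⟨S, hS, by rw [rhoM, Matrix.mul_one]⟩
    obtain ⟨hS, hyS⟩ := hex.choose_spec
    obtain ⟨T, hT, hTS, hTS'⟩ := hH _ hS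
    rw [rhoM, Matrix.mul_one, hTS'] at hyS
    rw [DeltaDef, dif_pos hex, ← hTS, R.chi_dualMap (mem_Hgrp.1 hT).1, LinearMap.comp_apply]
    conv_rhs => rw [hyS]
    rw [hl _ (hZ T hT), hδ s T hT]

end Wishart
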